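/- Perfect encryption of a qubit by the X^i Z_{kπ/4} one-time pad used in UBQC (Step 1(a) of Protocol 1): For every 2×2 complex matrix ρ, (1/16) · ∑_{i∈{0,1}} ∑_{k=0}^{7} X^i Z_{kπ/4} ρ (Z_{kπ/4})ᴴ X^i = (tr ρ / 2) · I₂. In particular, averaged over the uniformly random keys (i, k), the encrypted qubit is maximally mixed and independent of ρ. -/

import Mathlib

open Matrix

noncomputable section

/-- Pauli-X gate. -/
def Xgate : Matrix (Fin 2) (Fin 2) ℂ := !![0, 1; 1, 0]

/-- Parametrized phase gate `Z_θ = diag(1, e^{iθ})`. -/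
def Zrot (θ : ℝ) : Matrix (Fin 2) (Fin 2) ℂ := !![1, 0; 0, Complex.exp (θ * Complex.I)]

theorem Zrot_mul_mul_conjTranspose (θ : ℝ) (ρ : Matrix (Fin 2) (Fin 2) ℂ) :
    Zrot θ * ρ * (Zrot θ)ᴴ =
      !![ρ 0 0, ρ 0 1 * star (Complex.exp (θ * Complex.I));
        Complex.exp (θ * Complex.I) * ρ 1 0, ρ 1 1] := by
  have h : Complex.exp (θ * Complex.I) * starRingEnd ℂ (Complex.exp (θ * Complex.I)) = 1 := by
    rw [Complex.mul_conj, Complex.normSq_eq_norm_sq, Complex.norm_exp_ofReal_mul_I]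
    norm_num
  ext i j
  fin_cases i <;> fin_cases j <;>
    simp [Zrot, Matrix.mul_apply, Matrix.vecMul, dotProduct, Fin.sum_univ_two,
      Matrix.conjTranspose_apply]
  linear_combination ρ 1 1 * h

theorem Xgate_mul_mul_Xgate (A : Matrix (Fin 2) (Fin 2) ℂ) :
    Xgate * A * Xgate = !![A 1 1, A 1 0; A 0 1, A 0 0] := by
  ext i j
  fin_cases i <;> fin_cases j <;>
    simp [Xgate, Matrix.mul_apply, Matrix.vecMul, dotProduct, Fin.sum_univ_two]

/-- The eighth roots of unity sum to zero. -/
theorem sum_exp_mul_pi_div_four :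
    ∑ k : Fin 8, Complex.exp ((((k : ℕ) * Real.pi / 4 : ℝ) : ℂ) * Complex.I) = 0 := by
  have hζ : IsPrimitiveRoot (Complex.exp (2 * Real.pi * Complex.I / (8 : ℕ))) 8 :=
    Complex.isPrimitiveRoot_exp 8 (by norm_num)
  rw [← hζ.geom_sum_eq_zero (by norm_num), ← Fin.sum_univ_eq_sum_range]
  refine Finset.sum_congr rfl fun k _ => ?_
  rw [← Complex.exp_nat_mul]
  congr 1
  push_cast
  ring

/-- Perfect encryption of a qubit by the `X^i Z_{kπ/4}` one-time pad used in UBQC: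
averaged over the uniformly random keys `(i, k)`, the encrypted qubit is maximally
mixed and independent of `ρ`. -/
theorem ubqc_one_time_pad_perfect (ρ : Matrix (Fin 2) (Fin 2) ℂ) :
    (1 / 16 : ℂ) •
        ∑ i : Fin 2, ∑ k : Fin 8,
          Xgate ^ (i : ℕ) * Zrot ((k : ℕ) * Real.pi / 4) * ρ *
            (Zrot ((k : ℕ) * Real.pi / 4))ᴴ * Xgate ^ (i : ℕ)
      = (ρ.trace / 2) • (1 : Matrix (Fin 2) (Fin 2) ℂ) := by
  have hX : ∀ A : Matrix (Fin 2) (Fin 2) ℂ, ∀ θ : ℝ,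
      Xgate * Zrot θ * A * (Zrot θ)ᴴ * Xgate = Xgate * (Zrot θ * A * (Zrot θ)ᴴ) * Xgate := by
    intro A θ
    simp only [Matrix.mul_assoc]
  have hs := sum_exp_mul_pi_div_four
  have hs' := congrArg star hs
  rw [star_sum, star_zero] at hs'
  simp only [Complex.star_def] at hs'
  simp only [Fin.sum_univ_two, Fin.val_zero, Fin.val_one, pow_zero, pow_one, one_mul, mul_one,
    hX, Xgate_mul_mul_Xgate, Zrot_mul_mul_conjTranspose]
  ext i j
  fin_cases i <;> fin_cases j <;>
    simp [Matrix.sum_apply, Matrix.trace_fin_two, ← Finset.mul_sum, ← Finset.sum_mul,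
      -Complex.ofReal_div, -Complex.ofReal_mul, -map_sum, hs, hs'] <;> ring
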